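/- Let 𝔖 = S_{a_1} × ⋯ × S_{a_m} be a Young subgroup of S_n, ordered by the product of the Bruhat orders of its factors, and let [u,v] ⊆ 𝔖 be an interval in this order. Then Σ_{w ∈ 𝔖, u ≤ w ≤ v} (−1)^{ℓ(u)+ℓ(w)} equals 1 if u = v and 0 otherwise. -/

import Mathlib

open scoped Classical

namespace LSS

noncomputable section

open MvPolynomial

/-- The simple transposition `s_i ∈ S_n` (`1 ≤ i ≤ n-1`, 1-indexed): it exchanges the
letters `i` and `i+1` of `[n] = {1, …, n}`, realized on `Fin n` (0-indexed) as the swap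
of `i-1` and `i`. For `i` out of range it is the identity. -/
def st (n : ℕ) (i : ℕ) : Equiv.Perm (Fin n) :=
  if h : 0 < i ∧ i < n then Equiv.swap ⟨i - 1, by omega⟩ ⟨i, h.2⟩ else 1

/-- Coxeter length of `w ∈ S_n` = number of inversions. -/
def len (n : ℕ) (w : Equiv.Perm (Fin n)) : ℕ :=
  (Finset.univ.filter fun p : Fin n × Fin n => p.1 < p.2 ∧ w p.2 < w p.1).card

/-- `L` is a reduced word for `w`: a list of indices in `[n-1]` of length `ℓ(w)` whose
associated product of simple transpositions is `w`. -/
def IsRedWord (n : ℕ) (L : List ℕ) (w : Equiv.Perm (Fin n)) : Prop :=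
  (∀ i ∈ L, 1 ≤ i ∧ i ≤ n - 1) ∧ (L.map (st n)).prod = w ∧ L.length = len n w

/-- The left descent set `J(w) = {j ∈ [n-1] : ℓ(s_j w) < ℓ(w)}`. -/
def Descents (n : ℕ) (w : Equiv.Perm (Fin n)) : Set ℕ :=
  {j | 1 ≤ j ∧ j ≤ n - 1 ∧ len n (st n j * w) < len n w}

/-- The parabolic subgroup of `S_n` generated by `{s_i : i ∈ I}`. -/
def parab (n : ℕ) (I : Set ℕ) : Subgroup (Equiv.Perm (Fin n)) :=
  Subgroup.closure (st n '' I)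

/-- `u = w_0(I)`, the longest element of the parabolic subgroup generated by `{s_i : i ∈ I}`. -/
def IsLongest (n : ℕ) (I : Set ℕ) (u : Equiv.Perm (Fin n)) : Prop :=
  u ∈ parab n I ∧ ∀ v ∈ parab n I, len n v ≤ len n u

/-- `c` is a standard Coxeter element of some parabolic subgroup of `S_n`: a product of
the elements of some subset of `{s_1, …, s_{n-1}}`, each appearing exactly once, in some order. -/
def IsStdCox (n : ℕ) (c : Equiv.Perm (Fin n)) : Prop :=
  ∃ L : List ℕ, L.Nodup ∧ (∀ i ∈ L, 1 ≤ i ∧ i ≤ n - 1) ∧ (L.map (st n)).prod = c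

/-- A weak composition `β : Fin n → ℕ` as an exponent vector. -/
def expOf (n : ℕ) (β : Fin n → ℕ) : Fin n →₀ ℕ := Finsupp.equivFunOnFinite.symm β

/-- The monomial `x^β = x_1^{β_1} ⋯ x_n^{β_n}`. -/
def mono (n : ℕ) (β : Fin n → ℕ) : MvPolynomial (Fin n) ℤ := monomial (expOf n β) 1

/-- The coefficient `[x^β] f`. -/
def coeffOf (n : ℕ) (β : Fin n → ℕ) (f : MvPolynomial (Fin n) ℤ) : ℤ := coeff (expOf n β) f

/-- The isobaric divided difference (Demazure) operator
`π_i(f) = (x_i f − x_{i+1} s_i f)/(x_i − x_{i+1})` (1-indexed `i`), defined as the unique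
polynomial `g` with `(x_i − x_{i+1})·g = x_i f − x_{i+1} s_i f`; such a `g` always exists
and is unique since `ℤ[x_1,…,x_n]` is a domain. -/
def dem (n : ℕ) (i : ℕ) (f : MvPolynomial (Fin n) ℤ) : MvPolynomial (Fin n) ℤ :=
  if h : 0 < i ∧ i < n then
    if hg : ∃ g, (X (⟨i - 1, by omega⟩ : Fin n) - X (⟨i, h.2⟩ : Fin n)) * g =
        X (⟨i - 1, by omega⟩ : Fin n) * f -
          X (⟨i, h.2⟩ : Fin n) *
            rename (⇑(Equiv.swap (⟨i - 1, by omega⟩ : Fin n) (⟨i, h.2⟩ : Fin n))) f then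
      hg.choose
    else 0
  else f

/-- `π_{i_1} π_{i_2} ⋯ π_{i_ℓ} (f)` for a word `L = [i_1, …, i_ℓ]`. -/
def demWord (n : ℕ) (L : List ℕ) (f : MvPolynomial (Fin n) ℤ) : MvPolynomial (Fin n) ℤ :=
  L.foldr (dem n) f

/-- Entry accessor for a composition, 0-indexed position, default `0` out of range. -/
def ent (n : ℕ) (α : Fin n → ℕ) (p : ℕ) : ℕ := if h : p < n then α ⟨p, h⟩ else 0

/-- Exchange the entries of `α` in (0-indexed) positions `p` and `p+1`. -/
def swapAt (n : ℕ) (p : ℕ) (α : Fin n → ℕ) : Fin n → ℕ := fun m =>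
  if (m : ℕ) = p then ent n α (p + 1) else if (m : ℕ) = p + 1 then ent n α p else α m

/-- Auxiliary fuelled recursion computing the key polynomial `κ_α`:
if `α` is weakly decreasing, `κ_α = x^α`; otherwise, choosing an ascent `α_p < α_{p+1}`
(0-indexed `p`), `κ_α = π_{p+1}(κ_{α̂})` where `α̂` swaps the two entries.  The fuel
`n*n` in `keyPoly` strictly exceeds the number of co-inversions, which drops by one at
each step, so the recursion always terminates at a weakly decreasing composition. -/
def keyAux (n : ℕ) : ℕ → (Fin n → ℕ) → MvPolynomial (Fin n) ℤ
  | 0, α => mono n α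
  | k + 1, α =>
    if h : ∃ p : Fin n, ent n α p.1 < ent n α (p.1 + 1) then
      dem n (h.choose.1 + 1) (keyAux n k (swapAt n h.choose.1 α))
    else mono n α

/-- The key polynomial `κ_α`. -/
def keyPoly (n : ℕ) (α : Fin n → ℕ) : MvPolynomial (Fin n) ℤ := keyAux n (n * n) α

/-- `wλ`, the composition `(λ_{w⁻¹(1)}, …, λ_{w⁻¹(n)})`. -/
def pact (n : ℕ) (w : Equiv.Perm (Fin n)) (lam : Fin n → ℕ) : Fin n → ℕ :=
  fun i => lam (w⁻¹ i)

/-- `lam` is a partition (weakly decreasing vector) with at most `n` parts. -/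
def IsPartition (n : ℕ) (lam : Fin n → ℕ) : Prop := ∀ i j : Fin n, i ≤ j → lam j ≤ lam i

/-- Box `(c, r)` (column, row; both 1-indexed) belongs to the skyline diagram `D(α)`. -/
def InDiag (n : ℕ) (α : Fin n → ℕ) (c r : ℕ) : Prop :=
  1 ≤ c ∧ c ≤ n ∧ 1 ≤ r ∧ r ≤ ent n α (c - 1)

/-- `F` (value of box (column, row)) is a filling of `D(α)` that is flagged (labels in
column `c` are in `{1, …, c}`) and row distinct. -/
def IsTab (n : ℕ) (α : Fin n → ℕ) (F : ℕ → ℕ → ℕ) : Prop :=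
  (∀ c r, InDiag n α c r → 1 ≤ F c r ∧ F c r ≤ c) ∧
  ∀ c c' r, InDiag n α c r → InDiag n α c' r → c ≠ c' → F c r ≠ F c' r

/-- The weight of a filling: `wt(F)_i` = number of occurrences of the label `i`
(1-indexed; `Fin` position `i` records the label `i+1`). -/
def wt (n : ℕ) (α : Fin n → ℕ) (F : ℕ → ℕ → ℕ) : Fin n → ℕ := fun i =>
  ((Finset.Icc 1 n ×ˢ Finset.Icc 1 (Finset.univ.sup α)).filter fun p =>
    InDiag n α p.1 p.2 ∧ F p.1 p.2 = i.1 + 1).card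

/-- `leftmin_α(i) = min{α_j : j ≤ i}`. -/
def leftmin (n : ℕ) (α : Fin n → ℕ) (i : Fin n) : ℕ := sInf (α '' {j | j ≤ i})

/-- `rightmax_α(i) = max{α_j : j ≥ i}`. -/
def rightmax (n : ℕ) (α : Fin n → ℕ) (i : Fin n) : ℕ :=
  Finset.sup (Finset.univ.filter fun j => i ≤ j) α

/-- `d` records `0 = d_0 < d_1 < ⋯ < d_k < d_{k+1} = n`. -/
def BlockData (n k : ℕ) (d : Fin (k + 2) → ℕ) : Prop :=
  d 0 = 0 ∧ d (Fin.last (k + 1)) = n ∧ StrictMono d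

/-- `D = {d_1, …, d_k}` as a set of natural numbers. -/
def Dset (k : ℕ) (d : Fin (k + 2) → ℕ) : Set ℕ :=
  {m | ∃ t : Fin (k + 2), t ≠ 0 ∧ t ≠ Fin.last (k + 1) ∧ d t = m}

/-- `I = [n−1] ∖ D`. -/
def Iset (n k : ℕ) (d : Fin (k + 2) → ℕ) : Set ℕ :=
  {m | 1 ≤ m ∧ m ≤ n - 1 ∧ m ∉ Dset k d}

/-- Positions `i, j` (of `Fin n`, 0-indexed; 1-indexed letters `i+1, j+1`) lie in the same
block: some `t` has `d_t < i+1, j+1 ≤ d_{t+1}`. -/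
def SameBlock (n k : ℕ) (d : Fin (k + 2) → ℕ) (i j : Fin n) : Prop :=
  ∃ t : Fin (k + 1), d t.castSucc ≤ i.1 ∧ i.1 < d t.succ ∧ d t.castSucc ≤ j.1 ∧ j.1 < d t.succ

/-- The variables `X_t = {x_{d_t + 1}, …, x_{d_{t+1}}}` of the `t`-th block. -/
def blockVars (n k : ℕ) (d : Fin (k + 2) → ℕ) (t : Fin (k + 1)) : Finset (Fin n) :=
  Finset.univ.filter fun p => d t.castSucc ≤ p.1 ∧ p.1 < d t.succ

/-- Complete homogeneous symmetric polynomial of degree `m` in the variables `S`. -/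
def hPoly (n : ℕ) (S : Finset (Fin n)) (m : ℕ) : MvPolynomial (Fin n) ℤ :=
  ∑ f ∈ S.sym m, ((f : Multiset (Fin n)).map X).prod

/-- `h_z` for `z : ℤ`, with `h_z = 0` for `z < 0`. -/
def hZ (n : ℕ) (S : Finset (Fin n)) (z : ℤ) : MvPolynomial (Fin n) ℤ :=
  if 0 ≤ z then hPoly n S z.toNat else 0

/-- The Schur polynomial `s_lam` in the variable set `S`, for a partition `lam`
(1-indexed parts, at most `t` of them), via the Jacobi–Trudi determinant
`det(h_{lam_i − i + j})_{1 ≤ i,j ≤ t}`. -/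
def schurP (n : ℕ) (S : Finset (Fin n)) (t : ℕ) (lam : ℕ → ℕ) : MvPolynomial (Fin n) ℤ :=
  (Matrix.of fun i j : Fin t =>
    hZ n S ((lam (i.1 + 1) : ℤ) - (i.1 + 1) + (j.1 + 1))).det

/-- `γ ∈ Par_D`: a `(k+1)`-tuple of partitions, the `t`-th having at most
`d_{t+1} − d_t` nonzero parts (1-indexed parts; the unused index `0` is normalized to `0`). -/
def ParD (k : ℕ) (d : Fin (k + 2) → ℕ) (γ : Fin (k + 1) → ℕ → ℕ) : Prop :=
  ∀ t : Fin (k + 1), γ t 0 = 0 ∧ (∀ a b : ℕ, 1 ≤ a → a ≤ b → γ t b ≤ γ t a) ∧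
    ∀ m : ℕ, d t.succ - d t.castSucc < m → γ t m = 0

/-- The `D`-Schur polynomial `s_{γ^1,…,γ^{k+1}} = ∏_t s_{γ^t}(X_t)`. -/
def dSchur (n k : ℕ) (d : Fin (k + 2) → ℕ) (γ : Fin (k + 1) → ℕ → ℕ) :
    MvPolynomial (Fin n) ℤ :=
  ∏ t : Fin (k + 1), schurP n (blockVars n k d t) (d t.succ - d t.castSucc) (γ t)

/-- Truncation of an integer vector to a natural-number vector. -/
def toNatV (n : ℕ) (β : Fin n → ℤ) : Fin n → ℕ := fun i => (β i).toNat

/-- `j − i` as an integer. -/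
def gapZ (n : ℕ) (i j : Fin n) : ℤ := (j.1 : ℤ) - (i.1 : ℤ)

/-- The move `t_{ij}`: replace `β_i` by `β_j − (j−i)` and `β_j` by `β_i + (j−i)`. -/
def tmv (n : ℕ) (i j : Fin n) (β : Fin n → ℤ) : Fin n → ℤ := fun m =>
  if m = i then β j - gapZ n i j else if m = j then β i + gapZ n i j else β m

/-- The rank `θ(β) = #{(a,b) : a < b in the same block and β_a < β_b − (b−a)}`. -/
def theta (n k : ℕ) (d : Fin (k + 2) → ℕ) (β : Fin n → ℤ) : ℕ :=
  (Finset.univ.filter fun p : Fin n × Fin n =>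
    p.1 < p.2 ∧ SameBlock n k d p.1 p.2 ∧ β p.1 < β p.2 - gapZ n p.1 p.2).card

/-- One step up in the Bruhat-type order: `β ⋖ t_{ij} β` whenever `i < j` are in the same
block and `β_i > β_j − (j−i)`. -/
def stepUp (n k : ℕ) (d : Fin (k + 2) → ℕ) (β β' : Fin n → ℤ) : Prop :=
  ∃ i j : Fin n, i < j ∧ SameBlock n k d i j ∧ β j - gapZ n i j < β i ∧ β' = tmv n i j β

/-- The order on compositions: transitive (reflexive) closure of `stepUp`. -/
def leB (n k : ℕ) (d : Fin (k + 2) → ℕ) : (Fin n → ℤ) → (Fin n → ℤ) → Prop :=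
  Relation.ReflTransGen (stepUp n k d)

/-- Membership in the poset `P_{α,γ}` (for `α = cλ`): `β` is a weak composition with
`[x^β] κ_α ≠ 0` and `π_{w_0(I)}(x^β) = ± s_γ`. -/
def memP (n k : ℕ) (d : Fin (k + 2) → ℕ) (w0I : Equiv.Perm (Fin n)) (α : Fin n → ℕ)
    (γ : Fin (k + 1) → ℕ → ℕ) (β : Fin n → ℤ) : Prop :=
  (∀ i, 0 ≤ β i) ∧ coeffOf n (toNatV n β) (keyPoly n α) ≠ 0 ∧
  ∃ L, IsRedWord n L w0I ∧
    (demWord n L (mono n (toNatV n β)) = dSchur n k d γ ∨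
     demWord n L (mono n (toNatV n β)) = -dSchur n k d γ)

/-- The pair `i < j` is interweaved for `α`: `α_m ≥ α_{m+1}` for `i ≤ m < j`,
`leftmin_α(i) < α_i` and `rightmax_α(j) > α_j`. -/
def Interweaved (n : ℕ) (α : Fin n → ℕ) (i j : Fin n) : Prop :=
  i < j ∧ (∀ p : Fin n, i ≤ p → p < j → ent n α (p.1 + 1) ≤ α p) ∧
  leftmin n α i < α i ∧ α j < rightmax n α j

/-- `center_α(i,j) = max{m : i ≤ m ≤ j and α_m ≥ rightmax_α(j)}` (as a 0-indexed position). -/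
def center (n : ℕ) (α : Fin n → ℕ) (i j : Fin n) : ℕ :=
  Finset.sup (Finset.univ.filter fun p : Fin n => i ≤ p ∧ p ≤ j ∧ rightmax n α j ≤ α p)
    fun p => p.1

/-- Partial sum `β_1 + ⋯ + β_{m+1}` (0-indexed positions `≤ m`) of an integer vector. -/
def psumZ (n : ℕ) (β : Fin n → ℤ) (m : ℕ) : ℤ :=
  ∑ p ∈ Finset.univ.filter (fun p : Fin n => p.1 ≤ m), β p

/-- Partial sum of a composition, as an integer. -/
def psumN (n : ℕ) (α : Fin n → ℕ) (m : ℕ) : ℤ :=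
  ∑ p ∈ Finset.univ.filter (fun p : Fin n => p.1 ≤ m), (α p : ℤ)

/-- Composition pattern containment. -/
def ContainsPat (n : ℕ) {m : ℕ} (α : Fin n → ℕ) (pat : Fin m → ℕ) : Prop :=
  ∃ g : Fin m → Fin n, StrictMono g ∧
    (∀ s t : Fin m, pat s ≤ pat t ↔ α (g s) ≤ α (g t)) ∧
    ∀ s t : Fin m, |(pat s : ℤ) - (pat t : ℤ)| ≤ |(α (g s) : ℤ) - (α (g t) : ℤ)|

end

end LSS
namespace LSS

/-- Strong Bruhat order on `S_N` via the subword characterization: `u ≤ v` iff some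
reduced word of `v` contains a subword that is a reduced word of `u`. -/
def bruhat (N : ℕ) (u v : Equiv.Perm (Fin N)) : Prop :=
  ∃ Lv Lu : List ℕ, IsRedWord N Lv v ∧ IsRedWord N Lu u ∧ Lu.Sublist Lv

section aux

variable {n : ℕ}

/-- Rank function: number of positions `< p` with value `≥ j`. -/
noncomputable def rk (w : Equiv.Perm (Fin n)) (p j : ℕ) : ℕ :=
  (Finset.univ.filter fun x : Fin n => x.1 < p ∧ j ≤ (w x).1).card

/-- Rank order. -/
def rle (u v : Equiv.Perm (Fin n)) : Prop := ∀ p j, rk u p j ≤ rk v p j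

/-- Rank order away from row `b`. -/
def rleE (b : ℕ) (u v : Equiv.Perm (Fin n)) : Prop :=
  ∀ p j, j ≠ b → rk u p j ≤ rk v p j

/-- Left descent at the values `a`, `b`. -/
def dsc (a b : Fin n) (w : Equiv.Perm (Fin n)) : Prop := w⁻¹ b < w⁻¹ a

lemma rk_succ (w : Equiv.Perm (Fin n)) (p : ℕ) (c : Fin n) :
    rk w p c.1 = rk w p (c.1 + 1) + if (w⁻¹ c).1 < p then 1 else 0 := by
  unfold rk
  split_ifs with h
  · have : (Finset.univ.filter fun x : Fin n => x.1 < p ∧ c.1 ≤ (w x).1) =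
        insert (w⁻¹ c) (Finset.univ.filter fun x : Fin n => x.1 < p ∧ c.1 + 1 ≤ (w x).1) := by
      ext x
      simp only [Finset.mem_filter, Finset.mem_univ, true_and, Finset.mem_insert]
      constructor
      · rintro ⟨h1, h2⟩
        by_cases hx : w x = c
        · left; rw [← hx]; simp
        · right
          have : (w x).1 ≠ c.1 := fun h => hx (Fin.ext h)
          omega
      · rintro (rfl | h1)
        · simpa using h
        · omega
    rw [this, Finset.card_insert_of_notMem]
    simp
  · rw [add_zero]
    congr 1
    ext x
    simp only [Finset.mem_filter, Finset.mem_univ, true_and]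
    constructor
    · rintro ⟨h1, h2⟩
      by_cases hx : w x = c
      · exfalso; apply h; rw [← hx]; simpa using h1
      · have : (w x).1 ≠ c.1 := fun h => hx (Fin.ext h)
        omega
    · omega

lemma rk_swap (a b : Fin n) (hab : b.1 = a.1 + 1) (w : Equiv.Perm (Fin n)) (p j : ℕ)
    (hj : j ≠ b.1) : rk (Equiv.swap a b * w) p j = rk w p j := by
  unfold rk
  congr 1
  ext x
  rw [Finset.mem_filter, Finset.mem_filter]
  simp only [Finset.mem_univ, true_and, Equiv.Perm.mul_apply]
  rw [Equiv.swap_apply_def]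
  split_ifs with h1 h2
  · rw [h1]; omega
  · rw [h2]; omega
  · rfl

lemma rleE_left (a b : Fin n) (hab : b.1 = a.1 + 1) (u v : Equiv.Perm (Fin n)) :
    rleE b.1 (Equiv.swap a b * u) v ↔ rleE b.1 u v := by
  unfold rleE
  refine forall_congr' fun p => forall_congr' fun j => forall_congr' fun hj => ?_
  rw [rk_swap a b hab u p j hj]

lemma rleE_right (a b : Fin n) (hab : b.1 = a.1 + 1) (u v : Equiv.Perm (Fin n)) :
    rleE b.1 u (Equiv.swap a b * v) ↔ rleE b.1 u v := by
  unfold rleE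
  refine forall_congr' fun p => forall_congr' fun j => forall_congr' fun hj => ?_
  rw [rk_swap a b hab v p j hj]

lemma dsc_swap (a b : Fin n) (hab : b.1 = a.1 + 1) (w : Equiv.Perm (Fin n)) :
    dsc a b (Equiv.swap a b * w) ↔ ¬ dsc a b w := by
  unfold dsc
  simp only [mul_inv_rev, Equiv.swap_inv, Equiv.Perm.mul_apply, Equiv.swap_apply_left,
    Equiv.swap_apply_right, not_lt]
  have : w⁻¹ a ≠ w⁻¹ b := by
    intro h
    have := w⁻¹.injective h
    rw [this] at hab; omega
  exact ⟨le_of_lt, fun h => lt_of_le_of_ne h this⟩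

lemma rle_iff (a b : Fin n) (hab : b.1 = a.1 + 1) (u v : Equiv.Perm (Fin n))
    (h : dsc a b v ∨ ¬ dsc a b u) : rle u v ↔ rleE b.1 u v := by
  constructor
  · intro H p j _; exact H p j
  · intro H p j
    by_cases hj : j = b.1
    · subst hj
      have h1 := H p a.1 (by omega)
      have h2 := H p (b.1 + 1) (by omega)
      have e1 := rk_succ u p a
      have e2 := rk_succ u p b
      have e3 := rk_succ v p a
      have e4 := rk_succ v p b
      rw [← hab] at e1 e3
      unfold dsc at h
      rw [Fin.lt_def, Fin.lt_def] at h
      split_ifs at e1 e2 e3 e4 <;> omega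
    · exact H p j hj

lemma len_swap_of_not (a b : Fin n) (hab : b.1 = a.1 + 1) (w : Equiv.Perm (Fin n))
    (h : ¬ dsc a b w) : len n (Equiv.swap a b * w) = len n w + 1 := by
  have hne : w⁻¹ a ≠ w⁻¹ b := by
    intro h
    have := w⁻¹.injective h
    rw [this] at hab; omega
  have hlt : w⁻¹ a < w⁻¹ b := lt_of_le_of_ne (not_lt.mp h) hne
  have hwi : ∀ c, w (w⁻¹ c) = c := fun c => by simp
  unfold len
  have : (Finset.univ.filter fun p : Fin n × Fin n =>
        p.1 < p.2 ∧ (Equiv.swap a b * w) p.2 < (Equiv.swap a b * w) p.1) =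
      insert (w⁻¹ a, w⁻¹ b) (Finset.univ.filter fun p : Fin n × Fin n =>
        p.1 < p.2 ∧ w p.2 < w p.1) := by
    ext ⟨x, y⟩
    obtain ⟨c, rfl⟩ := w⁻¹.surjective x
    obtain ⟨d, rfl⟩ := w⁻¹.surjective y
    rw [Finset.mem_insert, Finset.mem_filter, Finset.mem_filter]
    simp only [Finset.mem_univ, true_and, Prod.mk.injEq,
      Equiv.Perm.mul_apply, hwi, EmbeddingLike.apply_eq_iff_eq]
    rw [Equiv.swap_apply_def, Equiv.swap_apply_def]
    have q : ∀ x y : Fin n, x.1 = y.1 → (w⁻¹ x).1 = (w⁻¹ y).1 := by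
      intro x y h
      rw [Fin.ext h]
    have q1 := q c a
    have q2 := q c b
    have q3 := q d a
    have q4 := q d b
    rw [Fin.lt_def] at hlt
    split_ifs <;> simp only [Fin.lt_def, Fin.ext_iff] at * <;> omega
  rw [this, Finset.card_insert_of_notMem]
  simp only [Finset.mem_filter, Finset.mem_univ, true_and, hwi, not_and]
  intro _
  rw [Fin.lt_def]; omega

lemma len_swap_of (a b : Fin n) (hab : b.1 = a.1 + 1) (w : Equiv.Perm (Fin n))
    (h : dsc a b w) : len n w = len n (Equiv.swap a b * w) + 1 := by
  have := len_swap_of_not a b hab (Equiv.swap a b * w) (by rw [dsc_swap a b hab]; simpa using h)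
  simpa [← mul_assoc] using this

lemma sgn_swap (a b : Fin n) (hab : b.1 = a.1 + 1) (w : Equiv.Perm (Fin n)) :
    (-1 : ℤ) ^ len n (Equiv.swap a b * w) = - (-1 : ℤ) ^ len n w := by
  by_cases h : dsc a b w
  · rw [len_swap_of a b hab w h, pow_succ]; ring
  · rw [len_swap_of_not a b hab w h, pow_succ]; ring

lemma len_one : len n 1 = 0 := by
  unfold len
  rw [Finset.card_eq_zero, Finset.filter_eq_empty_iff]
  rintro p - ⟨h1, h2⟩
  exact absurd h1 (not_lt.mpr h2.le)

lemma exists_dsc (w : Equiv.Perm (Fin n)) (hw : w ≠ 1) :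
    ∃ a b : Fin n, b.1 = a.1 + 1 ∧ dsc a b w := by
  by_contra hcon
  push Not at hcon
  apply hw
  have hne : ∀ a b : Fin n, b.1 = a.1 + 1 → w⁻¹ a < w⁻¹ b := by
    intro a b hab
    refine lt_of_le_of_ne (not_lt.mp (hcon a b hab)) ?_
    intro h
    have := w⁻¹.injective h
    rw [this] at hab; omega
  have hmono : StrictMono (w⁻¹ : Equiv.Perm (Fin n)) := by
    intro x y hxy
    obtain ⟨x, hx⟩ := x
    obtain ⟨y, hy⟩ := y
    simp only [Fin.mk_lt_mk] at hxy
    induction y, hxy using Nat.le_induction with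
    | base => exact hne _ _ rfl
    | succ y hxy ih => exact (ih (by omega)).trans (hne ⟨y, by omega⟩ ⟨y + 1, hy⟩ rfl)
  have h1 : w⁻¹ = 1 := by
    have := (hmono.orderIsoOfSurjective _ w⁻¹.surjective)
    have e : hmono.orderIsoOfSurjective _ w⁻¹.surjective = OrderIso.refl (Fin n) :=
      Subsingleton.elim _ _
    ext x
    have := congrArg (fun f => f x) e
    simpa using congrArg Fin.val this
  simpa using h1

lemma rle_refl (w : Equiv.Perm (Fin n)) : rle w w := fun _ _ => le_rfl

lemma rle_one (w : Equiv.Perm (Fin n)) (h : rle w 1) : w = 1 := by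
  have key : ∀ x : Fin n, (w x).1 ≤ x.1 := by
    intro x
    by_contra hx
    have h0 : rk (1 : Equiv.Perm (Fin n)) (x.1 + 1) (x.1 + 1) = 0 := by
      unfold rk
      rw [Finset.card_eq_zero, Finset.filter_eq_empty_iff]
      rintro y - ⟨h1, h2⟩
      simp at h2
      omega
    have h1 := h (x.1 + 1) (x.1 + 1)
    rw [h0] at h1
    unfold rk at h1
    have h2 := Finset.card_eq_zero.mp (Nat.le_zero.mp h1)
    rw [Finset.filter_eq_empty_iff] at h2
    exact h2 (Finset.mem_univ x) ⟨by omega, by omega⟩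
  by_contra hw
  have hs : ∑ x : Fin n, (w x).1 = ∑ x : Fin n, x.1 := Equiv.sum_comp w (fun x : Fin n => x.1)
  have := (Finset.sum_eq_sum_iff_of_le (fun x _ => key x)).mp hs
  apply hw
  ext x
  simpa using this x (Finset.mem_univ x)

/-- The alternating sum. -/
noncomputable def T (u v : Equiv.Perm (Fin n)) : ℤ :=
  ∑ w : Equiv.Perm (Fin n), if rle u w ∧ rle w v then (-1 : ℤ) ^ len n w else 0

lemma T_eq (k : ℕ) : ∀ u v : Equiv.Perm (Fin n), len n v = k →
    T u v = if u = v then (-1 : ℤ) ^ len n v else 0 := by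
  induction k with
  | zero =>
    intro u v hv
    have hv1 : v = 1 := by
      by_contra h
      obtain ⟨a, b, hab, hd⟩ := exists_dsc v h
      have := len_swap_of a b hab v hd
      omega
    subst hv1
    unfold T
    rw [Finset.sum_eq_single 1]
    · by_cases hu : u = 1
      · subst hu; simp [rle_refl]
      · rw [if_neg, if_neg hu]
        exact fun h => hu (rle_one u h.1)
    · intro w _ hw
      rw [if_neg]
      exact fun h => hw (rle_one w h.2)
    · simp
  | succ k ih =>
    intro u v hv
    have hv1 : v ≠ 1 := by
      rintro rfl
      rw [len_one] at hv; omega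
    obtain ⟨a, b, hab, hd⟩ := exists_dsc v hv1
    have hl := len_swap_of a b hab v hd
    have hss : ∀ w, Equiv.swap a b * (Equiv.swap a b * w) = w := by
      intro w; rw [← mul_assoc]; simp
    have hcomp : ∀ f : Equiv.Perm (Fin n) → ℤ, ∑ w, f (Equiv.swap a b * w) = ∑ w, f w :=
      fun f => Equiv.sum_comp (Equiv.mulLeft (Equiv.swap a b)) f
    by_cases hu : dsc a b u
    · -- both have the descent
      have hdsv : ¬ dsc a b (Equiv.swap a b * v) := by rw [dsc_swap a b hab]; simpa using hd
      have hdsu : ¬ dsc a b (Equiv.swap a b * u) := by rw [dsc_swap a b hab]; simpa using hu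
      have hrec : T u v = T u (Equiv.swap a b * v) -
          T (Equiv.swap a b * u) (Equiv.swap a b * v) := by
        unfold T
        rw [← Finset.sum_sub_distrib]
        set f : Equiv.Perm (Fin n) → ℤ := fun w =>
          if rle u w ∧ rle w v then (-1 : ℤ) ^ len n w else 0 with hf
        set g : Equiv.Perm (Fin n) → ℤ := fun w =>
          (if rle u w ∧ rle w (Equiv.swap a b * v) then (-1 : ℤ) ^ len n w else 0) -
          (if rle (Equiv.swap a b * u) w ∧ rle w (Equiv.swap a b * v) then
            (-1 : ℤ) ^ len n w else 0) with hg
        have hpt0 : ∀ w, ¬ dsc a b w →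
            f w + f (Equiv.swap a b * w) = g w + g (Equiv.swap a b * w) := by
          intro w hw
          have hw' : dsc a b (Equiv.swap a b * w) := by rw [dsc_swap a b hab]; exact hw
          have e1 : rle w v ↔ rleE b.1 w v := rle_iff a b hab _ _ (Or.inl hd)
          have e2 : rle (Equiv.swap a b * w) v ↔ rleE b.1 w v := by
            rw [rle_iff a b hab _ _ (Or.inl hd), rleE_left a b hab]
          have e3 : rle u (Equiv.swap a b * w) ↔ rleE b.1 u w := by
            rw [rle_iff a b hab _ _ (Or.inl hw'), rleE_right a b hab]
          have e4 : rle w (Equiv.swap a b * v) ↔ rleE b.1 w v := by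
            rw [rle_iff a b hab _ _ (Or.inr hw), rleE_right a b hab]
          have e5 : rle (Equiv.swap a b * u) w ↔ rleE b.1 u w := by
            rw [rle_iff a b hab _ _ (Or.inr hdsu), rleE_left a b hab]
          have e6 : rle (Equiv.swap a b * u) (Equiv.swap a b * w) ↔ rleE b.1 u w := by
            rw [rle_iff a b hab _ _ (Or.inr hdsu), rleE_left a b hab, rleE_right a b hab]
          simp only [hf, hg, e1, e2, e3, e4, e5, e6, sgn_swap a b hab w]
          split_ifs <;> simp_all
        have hpt : ∀ w, f w + f (Equiv.swap a b * w) = g w + g (Equiv.swap a b * w) := by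
          intro w
          by_cases hw : dsc a b w
          · have := hpt0 (Equiv.swap a b * w) (by rw [dsc_swap a b hab]; simpa using hw)
            rw [hss] at this
            linarith
          · exact hpt0 w hw
        have hsum := Finset.sum_congr (rfl : (Finset.univ : Finset (Equiv.Perm (Fin n))) = _)
          (fun w _ => hpt w)
        rw [Finset.sum_add_distrib, Finset.sum_add_distrib, hcomp f, hcomp g] at hsum
        linarith
      rw [hrec, ih _ _ (by omega), ih _ _ (by omega)]
      have hne : u ≠ Equiv.swap a b * v := by
        rintro rfl; exact hdsv hu
      rw [if_neg hne, sgn_swap a b hab]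
      simp only [mul_right_inj]
      split_ifs <;> simp
    · have hne : u ≠ v := by
        rintro rfl; exact hu hd
      rw [if_neg hne]
      have : T u v = - T u v := by
        conv_lhs => unfold T
        rw [← hcomp]
        unfold T
        rw [← Finset.sum_neg_distrib]
        refine Finset.sum_congr rfl fun w _ => ?_
        have e1 : rle (Equiv.swap a b * w) v ↔ rle w v := by
          rw [rle_iff a b hab _ _ (Or.inl hd), rle_iff a b hab _ _ (Or.inl hd),
            rleE_left a b hab]
        have e2 : rle u (Equiv.swap a b * w) ↔ rle u w := by
          rw [rle_iff a b hab _ _ (Or.inr hu), rle_iff a b hab _ _ (Or.inr hu),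
            rleE_right a b hab]
        simp only [e1, e2, sgn_swap a b hab w]
        split_ifs <;> simp
      linarith

lemma st_eq (i : ℕ) (hi : 1 ≤ i ∧ i ≤ n - 1) :
    ∃ a b : Fin n, b.1 = a.1 + 1 ∧ b.1 = i ∧ st n i = Equiv.swap a b := by
  have h : 0 < i ∧ i < n := by omega
  refine ⟨⟨i - 1, by omega⟩, ⟨i, h.2⟩, ?_, rfl, ?_⟩
  · simp; omega
  · unfold st; rw [dif_pos h]

lemma st_eq' (a b : Fin n) (hab : b.1 = a.1 + 1) : st n b.1 = Equiv.swap a b := by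
  obtain ⟨a', b', h1, h2, h3⟩ := st_eq (n := n) b.1 (by omega)
  have hb : b' = b := Fin.ext h2
  have ha : a' = a := Fin.ext (by omega)
  rw [h3, hb, ha]

lemma len_prod_le (L : List ℕ) (hL : ∀ i ∈ L, 1 ≤ i ∧ i ≤ n - 1) :
    len n (L.map (st n)).prod ≤ L.length := by
  induction L with
  | nil => simp [len_one]
  | cons i L ih =>
    have ih' := ih fun j hj => hL j (List.mem_cons_of_mem _ hj)
    obtain ⟨a, b, hab, -, hs⟩ := st_eq i (hL i List.mem_cons_self)
    simp only [List.map_cons, List.prod_cons, List.length_cons, hs]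
    by_cases h : dsc a b (L.map (st n)).prod
    · have := len_swap_of a b hab _ h
      omega
    · have := len_swap_of_not a b hab _ h
      omega

lemma redWord_cons (i : ℕ) (L : List ℕ) (w : Equiv.Perm (Fin n)) (h : IsRedWord n (i :: L) w) :
    ∃ a b : Fin n, b.1 = a.1 + 1 ∧ IsRedWord n L (Equiv.swap a b * w) ∧ dsc a b w ∧ b.1 = i := by
  obtain ⟨h1, h2, h3⟩ := h
  obtain ⟨a, b, hab, hb, hs⟩ := st_eq i (h1 i List.mem_cons_self)
  have hL : ∀ j ∈ L, 1 ≤ j ∧ j ≤ n - 1 := fun j hj => h1 j (List.mem_cons_of_mem _ hj)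
  have hle := len_prod_le L hL
  simp only [List.map_cons, List.prod_cons, List.length_cons, hs] at h2 h3
  have hw : Equiv.swap a b * w = (L.map (st n)).prod := by
    rw [← h2, ← mul_assoc]; simp
  have hd : dsc a b w := by
    by_contra hd
    have := len_swap_of_not a b hab w hd
    rw [hw] at this
    omega
  have := len_swap_of a b hab w hd
  exact ⟨a, b, hab, ⟨hL, hw.symm, by omega⟩, hd, hb⟩

lemma redWord_cons' (a b : Fin n) (hab : b.1 = a.1 + 1) (L : List ℕ) (w : Equiv.Perm (Fin n))
    (hd : dsc a b w) (h : IsRedWord n L (Equiv.swap a b * w)) : IsRedWord n (b.1 :: L) w := by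
  obtain ⟨h1, h2, h3⟩ := h
  refine ⟨?_, ?_, ?_⟩
  · intro j hj
    rcases List.mem_cons.mp hj with rfl | hj
    · omega
    · exact h1 j hj
  · rw [List.map_cons, List.prod_cons, h2, st_eq' a b hab, ← mul_assoc]; simp
  · have := len_swap_of a b hab w hd
    simp only [List.length_cons]
    omega

lemma rle_of_bruhat_aux (Lv Lu : List ℕ) (h : Lu.Sublist Lv) :
    ∀ u v : Equiv.Perm (Fin n), IsRedWord n Lv v → IsRedWord n Lu u → rle u v := by
  induction h with
  | slnil =>
    intro u v hv hu
    rw [← hv.2.1, ← hu.2.1]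
    exact rle_refl _
  | cons i h ih =>
    intro u v hv hu
    obtain ⟨a, b, hab, hv', hd, -⟩ := redWord_cons _ _ _ hv
    have := ih u _ hv' hu
    rw [rle_iff a b hab _ _ (Or.inl hd), ← rleE_right a b hab]
    exact fun p j _ => this p j
  | cons_cons i h ih =>
    intro u v hv hu
    obtain ⟨a, b, hab, hv', hd, hb⟩ := redWord_cons _ _ _ hv
    obtain ⟨a', b', hab', hu', hd', hb'⟩ := redWord_cons _ _ _ hu
    have e1 : b' = b := Fin.ext (by omega)
    have e2 : a' = a := Fin.ext (by omega)
    subst e1 e2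
    have := ih _ _ hv' hu'
    rw [rle_iff _ _ hab _ _ (Or.inl hd), ← rleE_right _ _ hab, ← rleE_left _ _ hab]
    exact fun p j _ => this p j

lemma redWord_one : IsRedWord n [] (1 : Equiv.Perm (Fin n)) :=
  ⟨by simp, by simp, by simp [len_one]⟩

lemma bruhat_of_rle (k : ℕ) : ∀ u v : Equiv.Perm (Fin n), len n v = k → rle u v →
    bruhat n u v := by
  induction k with
  | zero =>
    intro u v hv h
    have hv1 : v = 1 := by
      by_contra h
      obtain ⟨a, b, hab, hd⟩ := exists_dsc v h
      have := len_swap_of a b hab v hd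
      omega
    subst hv1
    rw [rle_one u h]
    exact ⟨[], [], redWord_one, redWord_one, List.Sublist.refl _⟩
  | succ k ih =>
    intro u v hv h
    have hv1 : v ≠ 1 := by
      rintro rfl
      rw [len_one] at hv; omega
    obtain ⟨a, b, hab, hd⟩ := exists_dsc v hv1
    have hl := len_swap_of a b hab v hd
    rw [rle_iff a b hab _ _ (Or.inl hd)] at h
    by_cases hu : dsc a b u
    · have h' : rle (Equiv.swap a b * u) (Equiv.swap a b * v) := by
        rw [rle_iff a b hab, rleE_left a b hab, rleE_right a b hab]
        · exact h
        · right
          rw [dsc_swap a b hab]; simpa using hu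
      obtain ⟨Lv, Lu, h1, h2, h3⟩ := ih _ _ (by omega) h'
      exact ⟨b.1 :: Lv, b.1 :: Lu, redWord_cons' a b hab _ _ hd h1,
        redWord_cons' a b hab _ _ hu h2, h3.cons_cons _⟩
    · have h' : rle u (Equiv.swap a b * v) := by
        rw [rle_iff a b hab _ _ (Or.inr hu), rleE_right a b hab]
        exact h
      obtain ⟨Lv, Lu, h1, h2, h3⟩ := ih _ _ (by omega) h'
      exact ⟨b.1 :: Lv, Lu, redWord_cons' a b hab _ _ hd h1, h2, h3.cons _⟩

lemma bruhat_iff (u v : Equiv.Perm (Fin n)) : bruhat n u v ↔ rle u v :=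
  ⟨fun ⟨Lv, Lu, h1, h2, h3⟩ => rle_of_bruhat_aux Lv Lu h3 u v h1 h2,
    fun h => bruhat_of_rle _ u v rfl h⟩

lemma single_sum (u v : Equiv.Perm (Fin n)) :
    (∑ w ∈ Finset.univ.filter (fun w => bruhat n u w ∧ bruhat n w v),
      (-1 : ℤ) ^ (len n u + len n w)) = if u = v then 1 else 0 := by
  have h := T_eq _ u v rfl
  unfold T at h
  rw [Finset.sum_filter]
  simp only [bruhat_iff, pow_add]
  have : ∀ w : Equiv.Perm (Fin n),
      (if rle u w ∧ rle w v then (-1 : ℤ) ^ len n u * (-1) ^ len n w else 0) =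
      (-1 : ℤ) ^ len n u * (if rle u w ∧ rle w v then (-1 : ℤ) ^ len n w else 0) := by
    intro w; split_ifs <;> simp
  rw [Finset.sum_congr rfl fun w _ => this w, ← Finset.mul_sum, h]
  split_ifs with huv
  · subst huv
    rw [← mul_pow]; simp
  · simp

end aux

/-- Lemma 5.7, Möbius function of an interval in a Young subgroup:
for an interval `[u,v]` in `𝔖 = S_{a_1} × ⋯ × S_{a_m}` (a Young subgroup of `S_n`),
`Σ_{u ≤ w ≤ v} (−1)^{ℓ(u)+ℓ(w)}` is `1` if `u = v` and `0` otherwise. -/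
theorem stmt11 (n m : ℕ) (a : Fin m → ℕ) (ha : ∑ t, a t = n)
    (u v : ∀ t : Fin m, Equiv.Perm (Fin (a t)))
    (huv : ∀ t, bruhat (a t) (u t) (v t)) :
    (∑ w ∈ Finset.univ.filter
        (fun w : ∀ t : Fin m, Equiv.Perm (Fin (a t)) =>
          (∀ t, bruhat (a t) (u t) (w t)) ∧ ∀ t, bruhat (a t) (w t) (v t)),
      (-1 : ℤ) ^ ((∑ t, len (a t) (u t)) + ∑ t, len (a t) (w t))) =
      if u = v then 1 else 0 := by
  have hset : Finset.univ.filter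
        (fun w : ∀ t : Fin m, Equiv.Perm (Fin (a t)) =>
          (∀ t, bruhat (a t) (u t) (w t)) ∧ ∀ t, bruhat (a t) (w t) (v t)) =
      Fintype.piFinset fun t => Finset.univ.filter
        (fun w => bruhat (a t) (u t) w ∧ bruhat (a t) w (v t)) := by
    ext w
    simp [Fintype.mem_piFinset, forall_and]
  have hterm : ∀ w : ∀ t : Fin m, Equiv.Perm (Fin (a t)),
      (-1 : ℤ) ^ ((∑ t, len (a t) (u t)) + ∑ t, len (a t) (w t)) =
      ∏ t, (-1 : ℤ) ^ (len (a t) (u t) + len (a t) (w t)) := by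
    intro w
    rw [← Finset.sum_add_distrib, Finset.prod_pow_eq_pow_sum]
  rw [hset, Finset.sum_congr rfl fun w _ => hterm w]
  rw [← Finset.prod_univ_sum (fun t => Finset.univ.filter
        (fun w => bruhat (a t) (u t) w ∧ bruhat (a t) w (v t)))
      (fun t w => (-1 : ℤ) ^ (len (a t) (u t) + len (a t) w))]
  rw [Finset.prod_congr rfl fun t _ => single_sum (u t) (v t)]
  split_ifs with h
  · subst h; simp
  · obtain ⟨t, ht⟩ := Function.ne_iff.mp h
    exact Finset.prod_eq_zero (Finset.mem_univ t) (if_neg ht)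

end LSS
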